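/- arXiv:1311.4146 — 3 statements merged into one kernel-verified Lean document; each statement's English description precedes it below -/
import Mathlib

section
/- Let N ≥ 2, r > 0, δ ∈ πrℤ, and let τ ∈ ℂ with Re τ = 0 and Im τ > 0. Let u = (u_1,…,u_N) ∈ ℝ^N satisfy 0 ≤ u_1 < u_2 < ⋯ < u_N < 2πr and ū_δ := δ + Σ_{j=1}^N u_j ∈ (0, 2πr). Then for every x = (x_1,…,x_N) ∈ ℝ^N, with x̄_δ := δ + Σ_{j=1}^N x_j: det_{1≤j,k≤N}[ (ϑ1((ū_δ + x_j − u_k)/(2πr); τ) / ϑ1(ū_δ/(2πr); τ)) · ∏_{1≤ℓ≤N, ℓ≠k} ϑ1((x_j − u_ℓ)/(2πr); τ)/ϑ1((u_k − u_ℓ)/(2πr); τ) ] = (ϑ1(x̄_δ/(2πr); τ)/ϑ1(ū_δ/(2πr); τ)) · ∏_{1≤j<k≤N} ϑ1((x_j − x_k)/(2πr); τ)/ϑ1((u_j − u_k)/(2πr); τ). -/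
/-- The Jacobi theta function
`ϑ1(v;τ) = i ∑_{n ∈ ℤ} (-1)^n e^{iπτ(n-1/2)^2} e^{iπ(2n-1)v}`. -/
noncomputable def theta1 (v τ : ℂ) : ℂ :=
  Complex.I * ∑' n : ℤ, (-1 : ℂ) ^ n *
    Complex.exp (Real.pi * Complex.I * τ * ((n : ℂ) - 1 / 2) ^ 2) *
    Complex.exp (Real.pi * Complex.I * (2 * (n : ℂ) - 1) * v)

open Complex in
lemma th_term_eq (n : ℤ) (v τ : ℂ) : (-1 : ℂ) ^ n *
    Complex.exp (Real.pi * Complex.I * τ * ((n : ℂ) - 1 / 2) ^ 2) *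
    Complex.exp (Real.pi * Complex.I * (2 * (n : ℂ) - 1) * v) =
    cexp (Real.pi * I * τ / 4 - Real.pi * I * v) *
      jacobiTheta₂_term n (v - τ / 2 + 1 / 2) τ := by
  rw [jacobiTheta₂_term, ← Complex.exp_pi_mul_I, ← Complex.exp_int_mul, ← Complex.exp_add,
    ← Complex.exp_add, ← Complex.exp_add]
  congr 1
  ring

lemma theta1_eq (v τ : ℂ) : theta1 v τ =
    Complex.I * (Complex.exp (Real.pi * Complex.I * τ / 4 - Real.pi * Complex.I * v) *
      jacobiTheta₂ (v - τ / 2 + 1 / 2) τ) := by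
  rw [theta1, jacobiTheta₂]
  simp_rw [th_term_eq, tsum_mul_left]

lemma theta1_differentiable {τ : ℂ} (hτ : 0 < τ.im) : Differentiable ℂ (fun v => theta1 v τ) := by
  simp_rw [theta1_eq]
  have h : Differentiable ℂ (fun v : ℂ => jacobiTheta₂ (v - τ / 2 + 1 / 2) τ) := by
    intro v
    exact DifferentiableAt.comp v (g := fun z => jacobiTheta₂ z τ)
      (differentiableAt_jacobiTheta₂_fst _ hτ) (by fun_prop)
  fun_prop

/-- Splitting of pairs of integers by the parity of their sum. -/
def pairEquiv : (ℤ × ℤ) ⊕ (ℤ × ℤ) ≃ ℤ × ℤ where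
  toFun := Sum.elim (fun p => (p.1 + p.2 + 1, p.1 - p.2 + 1)) (fun p => (p.1 + p.2 + 1, p.1 - p.2))
  invFun := fun q => if (q.1 + q.2) % 2 = 0 then
      Sum.inl ((q.1 + q.2) / 2 - 1, (q.1 - q.2) / 2)
    else Sum.inr ((q.1 + q.2 - 1) / 2, (q.1 - q.2 - 1) / 2)
  left_inv := by
    rintro (⟨s, t⟩ | ⟨s, t⟩)
    · exact (if_pos (show (s + t + 1 + (s - t + 1)) % 2 = 0 by omega)).trans
        (congrArg Sum.inl (Prod.ext (show (s + t + 1 + (s - t + 1)) / 2 - 1 = s by omega)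
          (show (s + t + 1 - (s - t + 1)) / 2 = t by omega)))
    · exact (if_neg (show ¬ (s + t + 1 + (s - t)) % 2 = 0 by omega)).trans
        (congrArg Sum.inr (Prod.ext (show (s + t + 1 + (s - t) - 1) / 2 = s by omega)
          (show (s + t + 1 - (s - t) - 1) / 2 = t by omega)))
  right_inv := by
    rintro ⟨m, n⟩
    by_cases h : (m + n) % 2 = 0
    · simp only [h, if_true, Sum.elim_inl]
      congr 1 <;> omega
    · simp only [h, if_false, Sum.elim_inr]
      congr 1 <;> omega

open Complex in
/-- The even part. -/
noncomputable def thE (τ x : ℂ) : ℂ := jacobiTheta₂ (2 * x) (2 * τ)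
open Complex in
/-- The odd part. -/
noncomputable def thO (τ x : ℂ) : ℂ :=
  cexp (Real.pi * I * τ / 2 + 2 * Real.pi * I * x) * jacobiTheta₂ (2 * x + τ) (2 * τ)

/-- The summand. -/
noncomputable def thT (τ v : ℂ) (n : ℤ) : ℂ := (-1 : ℂ) ^ n *
    Complex.exp (Real.pi * Complex.I * τ * ((n : ℂ) - 1 / 2) ^ 2) *
    Complex.exp (Real.pi * Complex.I * (2 * (n : ℂ) - 1) * v)

open Complex in
lemma thT_one (τ x y : ℂ) (s t : ℤ) :
    thT τ (x + y) (s + t + 1) * thT τ (x - y) (s - t + 1) =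
    (cexp (Real.pi * I * τ / 2 + 2 * Real.pi * I * x) *
      jacobiTheta₂_term s (2 * x + τ) (2 * τ)) * jacobiTheta₂_term t (2 * y) (2 * τ) := by
  have h1 : (-1 : ℂ) ^ (s + t + 1) * (-1 : ℂ) ^ (s - t + 1) = 1 := by
    rw [← zpow_add₀ (by norm_num)]
    exact Even.neg_one_zpow ⟨s + 1, by ring⟩
  have h2 : cexp (Real.pi * I * τ * (((s + t + 1 : ℤ) : ℂ) - 1 / 2) ^ 2) *
      cexp (Real.pi * I * (2 * ((s + t + 1 : ℤ) : ℂ) - 1) * (x + y)) *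
      (cexp (Real.pi * I * τ * (((s - t + 1 : ℤ) : ℂ) - 1 / 2) ^ 2) *
      cexp (Real.pi * I * (2 * ((s - t + 1 : ℤ) : ℂ) - 1) * (x - y))) =
      (cexp (Real.pi * I * τ / 2 + 2 * Real.pi * I * x) *
      jacobiTheta₂_term s (2 * x + τ) (2 * τ)) * jacobiTheta₂_term t (2 * y) (2 * τ) := by
    simp only [jacobiTheta₂_term, ← Complex.exp_add]
    congr 1
    push_cast
    ring
  rw [← h2, thT, thT]
  linear_combination (cexp (Real.pi * I * τ * (((s + t + 1 : ℤ) : ℂ) - 1 / 2) ^ 2) *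
      cexp (Real.pi * I * (2 * ((s + t + 1 : ℤ) : ℂ) - 1) * (x + y)) *
      (cexp (Real.pi * I * τ * (((s - t + 1 : ℤ) : ℂ) - 1 / 2) ^ 2) *
      cexp (Real.pi * I * (2 * ((s - t + 1 : ℤ) : ℂ) - 1) * (x - y)))) * h1

open Complex in
lemma thT_two (τ x y : ℂ) (s t : ℤ) :
    thT τ (x + y) (s + t + 1) * thT τ (x - y) (s - t) =
    -(jacobiTheta₂_term s (2 * x) (2 * τ) * (cexp (Real.pi * I * τ / 2 + 2 * Real.pi * I * y) *
      jacobiTheta₂_term t (2 * y + τ) (2 * τ))) := by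
  have h1 : (-1 : ℂ) ^ (s + t + 1) * (-1 : ℂ) ^ (s - t) = -1 := by
    rw [← zpow_add₀ (by norm_num)]
    exact Odd.neg_one_zpow ⟨s, by ring⟩
  have h2 : cexp (Real.pi * I * τ * (((s + t + 1 : ℤ) : ℂ) - 1 / 2) ^ 2) *
      cexp (Real.pi * I * (2 * ((s + t + 1 : ℤ) : ℂ) - 1) * (x + y)) *
      (cexp (Real.pi * I * τ * (((s - t : ℤ) : ℂ) - 1 / 2) ^ 2) *
      cexp (Real.pi * I * (2 * ((s - t : ℤ) : ℂ) - 1) * (x - y))) =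
      (jacobiTheta₂_term s (2 * x) (2 * τ) * (cexp (Real.pi * I * τ / 2 + 2 * Real.pi * I * y) *
      jacobiTheta₂_term t (2 * y + τ) (2 * τ))) := by
    simp only [jacobiTheta₂_term, ← Complex.exp_add]
    congr 1
    push_cast
    ring
  rw [← h2, thT, thT]
  linear_combination (cexp (Real.pi * I * τ * (((s + t + 1 : ℤ) : ℂ) - 1 / 2) ^ 2) *
      cexp (Real.pi * I * (2 * ((s + t + 1 : ℤ) : ℂ) - 1) * (x + y)) *
      (cexp (Real.pi * I * τ * (((s - t : ℤ) : ℂ) - 1 / 2) ^ 2) *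
      cexp (Real.pi * I * (2 * ((s - t : ℤ) : ℂ) - 1) * (x - y)))) * h1

lemma hasSum_mul_aux {f g : ℤ → ℂ} {a b : ℂ} (hf : HasSum f a) (hg : HasSum g b) :
    HasSum (fun p : ℤ × ℤ => f p.1 * g p.2) (a * b) :=
  hf.mul hg (summable_mul_of_summable_norm hf.summable.norm hg.summable.norm)

open Complex in
lemma theta1_mul {τ : ℂ} (hτ : 0 < τ.im) (x y : ℂ) :
    theta1 (x + y) τ * theta1 (x - y) τ = thE τ x * thO τ y - thO τ x * thE τ y := by
  have h2 : 0 < (2 * τ).im := by simpa using hτ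
  have hTs : ∀ v, Summable (thT τ v) := by
    intro v
    have := ((summable_jacobiTheta₂_term_iff (v - τ / 2 + 1 / 2) τ).2 hτ).mul_left
      (cexp (Real.pi * I * τ / 4 - Real.pi * I * v))
    exact this.congr (fun n => (th_term_eq n v τ).symm)
  have hE : ∀ x, HasSum (fun n : ℤ => jacobiTheta₂_term n (2 * x) (2 * τ)) (thE τ x) :=
    fun x => hasSum_jacobiTheta₂_term _ h2
  have hO : ∀ x, HasSum (fun n : ℤ => cexp (Real.pi * I * τ / 2 + 2 * Real.pi * I * x) *
      jacobiTheta₂_term n (2 * x + τ) (2 * τ)) (thO τ x) :=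
    fun x => (hasSum_jacobiTheta₂_term _ h2).mul_left _
  have hEO : HasSum (fun p : ℤ × ℤ => -(jacobiTheta₂_term p.1 (2 * x) (2 * τ) *
      (cexp (Real.pi * I * τ / 2 + 2 * Real.pi * I * y) *
      jacobiTheta₂_term p.2 (2 * y + τ) (2 * τ)))) (-(thE τ x * thO τ y)) :=
    (hasSum_mul_aux (hE x) (hO y)).neg
  have hOE := hasSum_mul_aux (hO x) (hE y)
  have hTT := hasSum_mul_aux (hTs (x + y)).hasSum (hTs (x - y)).hasSum
  rw [← pairEquiv.hasSum_iff] at hTT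
  have key := hTT.unique (HasSum.sum (a := thO τ x * thE τ y) (b := -(thE τ x * thO τ y))
    (by
      convert hOE using 1
      funext p
      exact thT_one τ x y p.1 p.2)
    (by
      convert hEO using 1
      funext p
      exact thT_two τ x y p.1 p.2))
  have e : theta1 (x + y) τ * theta1 (x - y) τ =
      I * I * ((∑' n, thT τ (x + y) n) * ∑' n, thT τ (x - y) n) := by
    simp only [theta1, thT]; ring
  rw [e, key, I_mul_I]; ring

lemma theta1_odd {τ : ℂ} (hτ : 0 < τ.im) (v : ℂ) : theta1 (-v) τ = - theta1 v τ := by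
  by_cases h : ∃ s, theta1 s τ ≠ 0
  · obtain ⟨s, hs⟩ := h
    have h1 := theta1_mul hτ ((s + v) / 2) ((s - v) / 2)
    have h2 := theta1_mul hτ ((s - v) / 2) ((s + v) / 2)
    rw [show (s + v) / 2 + (s - v) / 2 = s by ring,
      show (s + v) / 2 - (s - v) / 2 = v by ring] at h1
    rw [show (s - v) / 2 + (s + v) / 2 = s by ring,
      show (s - v) / 2 - (s + v) / 2 = -v by ring] at h2
    apply mul_left_cancel₀ hs
    rw [h2, mul_neg, h1]; ring
  · push Not at h
    simp [h]

lemma theta1_three {τ : ℂ} (hτ : 0 < τ.im) (S y a b c : ℂ) :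
    theta1 (S + a - b) τ * theta1 (y - b) τ * theta1 (y + S - c) τ * theta1 (a - c) τ =
    theta1 (y + S - b) τ * theta1 (a - b) τ * theta1 (a + S - c) τ * theta1 (y - c) τ -
    theta1 S τ * theta1 (y + S + a - b - c) τ * theta1 (c - b) τ * theta1 (y - a) τ := by
  set p1 := (y + a - b - c) / 2 + S with h1
  set p2 := (y + a - b - c) / 2 with h2
  set p3 := (y - a + c - b) / 2 with h3
  set p4 := (y - a - c + b) / 2 with h4
  have e12 := theta1_mul hτ p1 p2
  have e34 := theta1_mul hτ p3 p4
  have e13 := theta1_mul hτ p1 p3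
  have e24 := theta1_mul hτ p2 p4
  have e14 := theta1_mul hτ p1 p4
  have e23 := theta1_mul hτ p2 p3
  rw [show p1 + p2 = y + S + a - b - c by rw [h1, h2]; ring,
    show p1 - p2 = S by rw [h1, h2]; ring] at e12
  rw [show p3 + p4 = y - a by rw [h3, h4]; ring,
    show p3 - p4 = c - b by rw [h3, h4]; ring] at e34
  rw [show p1 + p3 = y + S - b by rw [h1, h3]; ring,
    show p1 - p3 = a + S - c by rw [h1, h3]; ring] at e13
  rw [show p2 + p4 = y - c by rw [h2, h4]; ring,
    show p2 - p4 = a - b by rw [h2, h4]; ring] at e24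
  rw [show p1 + p4 = y + S - c by rw [h1, h4]; ring,
    show p1 - p4 = S + a - b by rw [h1, h4]; ring] at e14
  rw [show p2 + p3 = y - b by rw [h2, h3]; ring,
    show p2 - p3 = a - c by rw [h2, h3]; ring] at e23
  calc _ = (theta1 (y + S - c) τ * theta1 (S + a - b) τ) *
        (theta1 (y - b) τ * theta1 (a - c) τ) := by ring
    _ = (theta1 (y + S - b) τ * theta1 (a + S - c) τ) *
        (theta1 (y - c) τ * theta1 (a - b) τ) -
        (theta1 (y + S + a - b - c) τ * theta1 S τ) * (theta1 (y - a) τ * theta1 (c - b) τ) := by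
      rw [e12, e34, e13, e24, e14, e23]; ring
    _ = _ := by ring

lemma interp_step {θ : ℂ → ℂ} (hodd : ∀ v, θ (-v) = -θ v)
    (h3 : ∀ S y a b c : ℂ, θ (S + a - b) * θ (y - b) * θ (y + S - c) * θ (a - c) =
      θ (y + S - b) * θ (a - b) * θ (a + S - c) * θ (y - c) -
      θ S * θ (y + S + a - b - c) * θ (c - b) * θ (y - a))
    {ι : Type*} [DecidableEq ι] (s : Finset ι) (i : ι) (hi : i ∉ s) (a : ι → ℂ)
    (hai : ∀ k ∈ s, θ (a k - a i) ≠ 0)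
    (b : ι → ℂ) (y : ℂ)
    (ih : ∀ y, θ (∑ j ∈ s, (a j - b j)) * ∏ j ∈ s, θ (y - b j) =
      ∑ k ∈ s, θ (y + (∑ j ∈ s, (a j - b j)) - a k) * (∏ j ∈ s, θ (a k - b j)) *
        ∏ l ∈ s.erase k, (θ (y - a l) / θ (a k - a l))) :
    θ (∑ j ∈ s, (a j - b j)) *
    (θ (∑ j ∈ insert i s, (a j - b j)) * ∏ j ∈ insert i s, θ (y - b j)) =
    θ (∑ j ∈ s, (a j - b j)) *
      ∑ k ∈ insert i s, θ (y + (∑ j ∈ insert i s, (a j - b j)) - a k) *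
        (∏ j ∈ insert i s, θ (a k - b j)) *
        ∏ l ∈ (insert i s).erase k, (θ (y - a l) / θ (a k - a l)) := by
  rw [Finset.sum_insert hi, Finset.sum_insert hi, Finset.prod_insert hi, Finset.prod_insert hi,
    Finset.erase_insert hi]
  have hT : ∀ k ∈ s, θ (y + (a i - b i + ∑ j ∈ s, (a j - b j)) - a k) *
        (∏ j ∈ insert i s, θ (a k - b j)) *
        ∏ l ∈ (insert i s).erase k, (θ (y - a l) / θ (a k - a l)) =
      θ (y + (a i - b i + ∑ j ∈ s, (a j - b j)) - a k) *
        (θ (a k - b i) * ∏ j ∈ s, θ (a k - b j)) *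
        ((θ (y - a i) / θ (a k - a i)) *
          ∏ l ∈ s.erase k, (θ (y - a l) / θ (a k - a l))) := by
    intro k hk
    have hki : k ≠ i := fun h => hi (h ▸ hk)
    rw [Finset.prod_insert hi, Finset.erase_insert_of_ne hki.symm,
      Finset.prod_insert (fun h => hi (Finset.mem_of_mem_erase h))]
  rw [Finset.sum_congr rfl hT]
  have ihy := ih y
  have iha := ih (a i)
  set S := ∑ j ∈ s, (a j - b j) with hS
  have hi0 : ∀ k ∈ s, θ (a i - a k) ≠ 0 := by
    intro k hk h
    apply hai k hk
    rw [← neg_sub, hodd, h, neg_zero]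
  -- the term coming from `i`
  have hterm : θ S * (θ (y + (a i - b i + S) - a i) *
      (θ (a i - b i) * ∏ j ∈ s, θ (a i - b j)) * ∏ l ∈ s, (θ (y - a l) / θ (a i - a l))) =
      ∑ k ∈ s, θ (y + S - b i) * θ (a i - b i) * (θ (a i + S - a k) *
        (∏ j ∈ s, θ (a k - b j)) * (θ (y - a k) / θ (a i - a k)) *
        ∏ l ∈ s.erase k, (θ (y - a l) / θ (a k - a l))) := by
    rw [show y + (a i - b i + S) - a i = y + S - b i by ring]
    calc _ = θ (y + S - b i) * θ (a i - b i) * (θ S * ∏ j ∈ s, θ (a i - b j)) *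
          ∏ l ∈ s, (θ (y - a l) / θ (a i - a l)) := by ring
      _ = _ := by
        rw [iha, Finset.mul_sum, Finset.sum_mul]
        refine Finset.sum_congr rfl fun k hk => ?_
        rw [← Finset.mul_prod_erase s (fun l => θ (y - a l) / θ (a i - a l)) hk]
        have : (∏ l ∈ s.erase k, (θ (a i - a l) / θ (a k - a l))) *
            (∏ l ∈ s.erase k, (θ (y - a l) / θ (a i - a l))) =
            ∏ l ∈ s.erase k, (θ (y - a l) / θ (a k - a l)) := by
          rw [← Finset.prod_mul_distrib]
          refine Finset.prod_congr rfl fun l hl => ?_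
          have := hi0 l (Finset.mem_of_mem_erase hl)
          field_simp
        rw [← this]; ring
  rw [mul_add, hterm, Finset.mul_sum, ← Finset.sum_add_distrib]
  calc _ = θ (S + a i - b i) * θ (y - b i) * (θ S * ∏ j ∈ s, θ (y - b j)) := by
        rw [show a i - b i + S = S + a i - b i by ring]; ring
    _ = _ := by
      rw [ihy, Finset.mul_sum]
      refine Finset.sum_congr rfl fun k hk => ?_
      have e := h3 S y (a i) (b i) (a k)
      have hne := hi0 k hk
      rw [show a k - a i = -(a i - a k) by ring, hodd,
        show y + (a i - b i + S) - a k = y + S + a i - b i - a k by ring]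
      have e' : θ (S + a i - b i) * θ (y - b i) * θ (y + S - a k) =
        (θ (y + S - b i) * θ (a i - b i) * θ (a i + S - a k) * θ (y - a k) -
          θ S * θ (y + S + a i - b i - a k) * θ (a k - b i) * θ (y - a i)) / θ (a i - a k) := by
        rw [eq_div_iff hne]; exact e
      calc _ = (θ (S + a i - b i) * θ (y - b i) * θ (y + S - a k)) * (∏ j ∈ s, θ (a k - b j)) *
            ∏ l ∈ s.erase k, (θ (y - a l) / θ (a k - a l)) := by ring
        _ = _ := by rw [e', div_neg]; ring

lemma interp {θ : ℂ → ℂ} (hd : Differentiable ℂ θ) (hodd : ∀ v, θ (-v) = -θ v)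
    (h3 : ∀ S y a b c : ℂ, θ (S + a - b) * θ (y - b) * θ (y + S - c) * θ (a - c) =
      θ (y + S - b) * θ (a - b) * θ (a + S - c) * θ (y - c) -
      θ S * θ (y + S + a - b - c) * θ (c - b) * θ (y - a))
    (hne : ∃ z, θ z ≠ 0)
    {ι : Type*} [DecidableEq ι] (s : Finset ι) (hs : s.Nonempty) (a : ι → ℂ) :
    (∀ k ∈ s, ∀ l ∈ s, k ≠ l → θ (a k - a l) ≠ 0) → ∀ (b : ι → ℂ) (y : ℂ),
    θ (∑ j ∈ s, (a j - b j)) * ∏ j ∈ s, θ (y - b j) =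
      ∑ k ∈ s, θ (y + (∑ j ∈ s, (a j - b j)) - a k) * (∏ j ∈ s, θ (a k - b j)) *
        ∏ l ∈ s.erase k, (θ (y - a l) / θ (a k - a l)) := by
  induction hs using Finset.Nonempty.cons_induction with
  | singleton i =>
    intro _ b y
    simp only [Finset.sum_singleton, Finset.prod_singleton, Finset.erase_singleton,
      Finset.prod_empty]
    rw [show y + (a i - b i) - a i = y - b i by ring]; ring
  | cons i s hi hs ih =>
    rw [Finset.cons_eq_insert]
    intro ha b y
    have ih' := ih fun k hk l hl h => ha k (Finset.mem_insert_of_mem hk) l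
      (Finset.mem_insert_of_mem hl) h
    have hstep := fun ε : ℂ => interp_step hodd h3 s i hi a
      (fun k hk => ha k (Finset.mem_insert_of_mem hk) i (Finset.mem_insert_self _ _)
        (fun h => hi (h ▸ hk))) (fun j => b j - ε) y (ih' (fun j => b j - ε))
    set F : ℂ → ℂ := fun ε => θ (∑ j ∈ s, (a j - (b j - ε))) with hF
    set G : ℂ → ℂ := fun ε =>
      θ (∑ j ∈ insert i s, (a j - (b j - ε))) * ∏ j ∈ insert i s, θ (y - (b j - ε)) -
      ∑ k ∈ insert i s, θ (y + (∑ j ∈ insert i s, (a j - (b j - ε))) - a k) *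
        (∏ j ∈ insert i s, θ (a k - (b j - ε))) *
        ∏ l ∈ (insert i s).erase k, (θ (y - a l) / θ (a k - a l)) with hG
    have hFd : Differentiable ℂ F := by fun_prop
    have hGd : Differentiable ℂ G := by fun_prop
    have hFG : ∀ ε ∈ (Set.univ : Set ℂ), F ε * G ε = 0 := by
      intro ε _
      rw [hF, hG]
      simp only
      rw [mul_sub, hstep ε, sub_self]
    rcases AnalyticOnNhd.eq_zero_or_eq_zero_of_mul_eq_zero
      (hFd.differentiableOn.analyticOnNhd isOpen_univ)
      (hGd.differentiableOn.analyticOnNhd isOpen_univ) hFG isPreconnected_univ with h | h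
    · exfalso
      obtain ⟨z, hz⟩ := hne
      apply hz
      have hc : (s.card : ℂ) ≠ 0 := by
        exact_mod_cast (Finset.card_pos.2 hs).ne'
      have := h ((z - ∑ j ∈ s, (a j - b j)) / s.card) (Set.mem_univ _)
      rw [hF] at this
      simp only at this
      rw [← this]
      congr 1
      simp only [sub_sub_eq_add_sub, add_sub_right_comm, Finset.sum_add_distrib, Finset.sum_const,
        nsmul_eq_mul]
      field_simp
      ring
    · have := h 0 (Set.mem_univ _)
      rw [hG] at this
      simpa [sub_eq_zero] using this

/-- The elliptic Vandermonde product. -/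
noncomputable def vand (θ : ℂ → ℂ) {n : ℕ} (x : Fin n → ℂ) : ℂ :=
  ∏ j : Fin n, ∏ k : Fin n, if j < k then θ (x j - x k) else 1

lemma sign_prod (n : ℕ) (k : Fin (n + 1)) :
    ∏ l : Fin n, (if k.succAbove l < k then (-1 : ℂ) else 1) = (-1) ^ (k : ℕ) := by
  have h : ∀ l : Fin n, (k.succAbove l < k) = ((l : ℕ) < (k : ℕ)) := by
    intro l
    rw [Fin.succAbove_lt_iff_castSucc_lt, Fin.lt_def, Fin.val_castSucc]
  simp only [h]
  rw [Finset.prod_ite, Finset.prod_const, Finset.prod_const_one, mul_one, Fin.card_filter_val_lt]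
  congr 1
  have := k.2
  omega

lemma vand_succAbove {θ : ℂ → ℂ} (hodd : ∀ v, θ (-v) = -θ v) {n : ℕ} (k : Fin (n + 1))
    (u : Fin (n + 1) → ℂ) : vand θ u = (-1) ^ (k : ℕ) * (∏ l, θ (u k - u (k.succAbove l))) *
      vand θ (fun l => u (k.succAbove l)) := by
  rw [vand, Fin.prod_univ_succAbove _ k]
  have h : ∀ j : Fin (n + 1), (∏ c : Fin (n + 1), if j < c then θ (u j - u c) else 1) =
      (if j < k then θ (u j - u k) else 1) *
        ∏ m, if j < k.succAbove m then θ (u j - u (k.succAbove m)) else 1 :=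
    fun j => Fin.prod_univ_succAbove _ k
  simp only [h]
  rw [if_neg (lt_irrefl k), one_mul, Finset.prod_mul_distrib, ← mul_assoc,
    ← Finset.prod_mul_distrib, ← sign_prod, ← Finset.prod_mul_distrib, vand]
  simp only [Fin.succAbove_lt_succAbove_iff]
  rw [← Finset.prod_mul_distrib, ← Finset.prod_mul_distrib]
  refine Finset.prod_congr rfl fun l _ => ?_
  congr 1
  rcases lt_or_gt_of_ne (Fin.succAbove_ne k l) with h | h
  · rw [if_neg h.not_gt, if_pos h, if_pos h, ← neg_sub, hodd]; ring
  · rw [if_pos h, if_neg h.not_gt, if_neg h.not_gt]; ring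

lemma vand_ne_zero {θ : ℂ → ℂ} {n : ℕ} (u : Fin n → ℂ)
    (hu : ∀ k l, k ≠ l → θ (u k - u l) ≠ 0) : vand θ u ≠ 0 := by
  refine Finset.prod_ne_zero_iff.2 fun j _ => Finset.prod_ne_zero_iff.2 fun k _ => ?_
  split_ifs with h
  · exact hu _ _ h.ne
  · exact one_ne_zero

lemma prod_erase_self {n : ℕ} (k : Fin (n + 1)) (f : Fin (n + 1) → ℂ) :
    ∏ l ∈ Finset.univ.erase k, f l = ∏ l, f (k.succAbove l) := by
  rw [← Finset.compl_singleton, ← Fin.image_succAbove_univ,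
    Finset.prod_image (fun a _ b _ h => Fin.succAbove_right_injective h)]

lemma prod_erase_succAbove {n : ℕ} (k : Fin (n + 1)) (l : Fin n) (f : Fin (n + 1) → ℂ) :
    ∏ m ∈ Finset.univ.erase (k.succAbove l), f m =
      f k * ∏ m ∈ Finset.univ.erase l, f (k.succAbove m) := by
  have h : Finset.univ.erase (k.succAbove l) =
      insert k ((Finset.univ.erase l).image k.succAbove) := by
    ext m
    rcases Fin.eq_self_or_eq_succAbove k m with h | ⟨m', h⟩
    · subst h
      simp [(Fin.succAbove_ne m l).symm]
    · subst h
      simp [Fin.succAbove_ne]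
  rw [h, Finset.prod_insert (by simp [Fin.succAbove_ne]),
    Finset.prod_image (fun a _ b _ h => Fin.succAbove_right_injective h)]

lemma frob {θ : ℂ → ℂ} (hd : Differentiable ℂ θ) (hodd : ∀ v, θ (-v) = -θ v)
    (h3 : ∀ S y a b c : ℂ, θ (S + a - b) * θ (y - b) * θ (y + S - c) * θ (a - c) =
      θ (y + S - b) * θ (a - b) * θ (a + S - c) * θ (y - c) -
      θ S * θ (y + S + a - b - c) * θ (c - b) * θ (y - a)) (n : ℕ) :
    ∀ (d U : ℂ) (x u : Fin n → ℂ), U = d + ∑ i, u i → θ U ≠ 0 →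
    (∀ k l, k ≠ l → θ (u k - u l) ≠ 0) →
    Matrix.det (Matrix.of fun j k : Fin n => (θ (U + x j - u k) / θ U) *
      ∏ l ∈ Finset.univ.erase k, θ (x j - u l) / θ (u k - u l)) =
    (θ (d + ∑ i, x i) / θ U) * (vand θ x / vand θ u) := by
  induction n with
  | zero =>
    intro d U x u hU hne _
    simp only [Finset.univ_eq_empty, Finset.sum_empty, add_zero] at hU
    simp [vand, ← hU, hne]
  | succ n ih =>
    intro d U x u hU hne hu
    rw [Matrix.det_succ_row_zero]
    have hminor : ∀ k : Fin (n + 1), ((Matrix.of fun j k : Fin (n + 1) =>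
        (θ (U + x j - u k) / θ U) *
        ∏ l ∈ Finset.univ.erase k, θ (x j - u l) / θ (u k - u l)).submatrix Fin.succ
          k.succAbove).det =
        (∏ j : Fin n, θ (x j.succ - u k)) * ((∏ l : Fin n, (θ (u (k.succAbove l) - u k))⁻¹) *
        ((θ (d + u k + ∑ i : Fin n, x i.succ) / θ U) * (vand θ (fun i : Fin n => x i.succ) /
          vand θ (fun l => u (k.succAbove l))))) := by
      intro k
      rw [← ih (d + u k) U (fun i => x i.succ) (fun l => u (k.succAbove l))
        (by rw [hU, Fin.sum_univ_succAbove _ k]; ring) hne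
        (fun a b h => hu _ _ (fun h' => h (Fin.succAbove_right_injective h'))),
        ← Matrix.det_mul_row, ← Matrix.det_mul_column]
      congr 1
      ext j l
      simp only [Matrix.submatrix_apply, Matrix.of_apply]
      rw [prod_erase_succAbove]
      ring
    have hterm : ∀ k : Fin (n + 1), (-1 : ℂ) ^ (k : ℕ) *
        (Matrix.of fun j k : Fin (n + 1) => (θ (U + x j - u k) / θ U) *
          ∏ l ∈ Finset.univ.erase k, θ (x j - u l) / θ (u k - u l)) 0 k *
        ((Matrix.of fun j k : Fin (n + 1) =>
        (θ (U + x j - u k) / θ U) *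
        ∏ l ∈ Finset.univ.erase k, θ (x j - u l) / θ (u k - u l)).submatrix Fin.succ
          k.succAbove).det =
        (θ (x 0 + U - u k) * (θ (u k + d + ∑ i : Fin n, x i.succ) *
          ∏ j : Fin n, θ (u k - x j.succ)) *
          ∏ l ∈ Finset.univ.erase k, θ (x 0 - u l) / θ (u k - u l)) *
        (vand θ (fun i : Fin n => x i.succ) / (θ U * θ U * vand θ u)) := by
      intro k
      rw [hminor k, Matrix.of_apply, vand_succAbove hodd k u]
      have hv : vand θ (fun l => u (k.succAbove l)) ≠ 0 := vand_ne_zero _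
        (fun a b h => hu _ _ (fun h' => h (Fin.succAbove_right_injective h')))
      have e1 : ∏ j : Fin n, θ (x j.succ - u k) =
          (-1) ^ n * ∏ j : Fin n, θ (u k - x j.succ) := by
        have : ∀ j : Fin n, θ (x j.succ - u k) = (-1) * θ (u k - x j.succ) := by
          intro j; rw [← neg_sub, hodd]; ring
        simp only [this, Finset.prod_mul_distrib, Finset.prod_inv_distrib, Finset.prod_const,
          Finset.card_univ, Fintype.card_fin]
      have e2 : ∏ l : Fin n, (θ (u (k.succAbove l) - u k))⁻¹ =
          (-1) ^ n * (∏ l : Fin n, θ (u k - u (k.succAbove l)))⁻¹ := by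
        have : ∀ l : Fin n, (θ (u (k.succAbove l) - u k))⁻¹ =
            (-1) * (θ (u k - u (k.succAbove l)))⁻¹ := by
          intro j; rw [← neg_sub, hodd, inv_neg]; ring
        simp only [this, Finset.prod_mul_distrib, Finset.prod_inv_distrib, Finset.prod_const,
          Finset.card_univ, Fintype.card_fin]
      have hP : ∏ l : Fin n, θ (u k - u (k.succAbove l)) ≠ 0 :=
        Finset.prod_ne_zero_iff.2 fun l _ => hu _ _ (Fin.succAbove_ne k l).symm
      rw [e1, e2, show U + x 0 - u k = x 0 + U - u k by ring,
        show d + u k + ∑ i : Fin n, x i.succ = u k + d + ∑ i : Fin n, x i.succ by ring]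
      have s1 : ((-1 : ℂ) ^ n) * (-1) ^ n = 1 := by rw [← mul_pow]; simp
      have s2 : ((-1 : ℂ) ^ (k : ℕ)) = ((-1 : ℂ) ^ (k : ℕ))⁻¹ := by
        rw [← inv_pow]; norm_num
      generalize ∏ l ∈ Finset.univ.erase k, θ (x 0 - u l) / θ (u k - u l) = Q
      generalize ∏ j : Fin n, θ (u k - x j.succ) = R
      generalize vand θ (fun l => u (k.succAbove l)) = V at *
      generalize ∏ l : Fin n, θ (u k - u (k.succAbove l)) = P at *
      generalize θ (x 0 + U - u k) = A
      generalize θ (u k + d + ∑ i : Fin n, x i.succ) = B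
      generalize vand θ (fun i : Fin n => x i.succ) = W
      rw [s2]
      calc _ = ((-1 : ℂ) ^ n * (-1) ^ n) * (((-1 : ℂ) ^ (k : ℕ))⁻¹ * (A / θ U * Q) *
              (R * (P⁻¹ * (B / θ U * (W / V))))) := by ring
        _ = _ := by
          rw [s1]
          simp only [div_eq_mul_inv, mul_inv, inv_inv]
          ring_nf
          ring
    rw [Finset.sum_congr rfl fun k _ => hterm k, ← Finset.sum_mul]
    have hI := interp hd hodd h3 ⟨U, hne⟩ (Finset.univ : Finset (Fin (n + 1)))
      Finset.univ_nonempty u (fun k _ l _ h => hu k l h)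
      (Fin.cons (-(d + ∑ i : Fin n, x i.succ)) (fun i : Fin n => x i.succ)) (x 0)
    have hsum : ∑ j, (u j - (Fin.cons (-(d + ∑ i : Fin n, x i.succ))
        (fun i : Fin n => x i.succ) : Fin (n + 1) → ℂ) j) = U := by
      rw [Finset.sum_sub_distrib, Fin.sum_univ_succ (n := n)
        (f := (Fin.cons (-(d + ∑ i : Fin n, x i.succ))
          (fun i : Fin n => x i.succ) : Fin (n + 1) → ℂ)), hU]
      simp only [Fin.cons_zero, Fin.cons_succ]
      ring
    rw [hsum] at hI
    have hI' : θ U * (θ (d + ∑ i, x i) * ∏ i : Fin n, θ (x 0 - x i.succ)) =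
        ∑ k, θ (x 0 + U - u k) * (θ (u k + d + ∑ i : Fin n, x i.succ) *
          ∏ j : Fin n, θ (u k - x j.succ)) *
          ∏ l ∈ Finset.univ.erase k, θ (x 0 - u l) / θ (u k - u l) := by
      rw [Fin.prod_univ_succ] at hI
      simp only [Fin.cons_zero, Fin.cons_succ] at hI
      rw [Fin.sum_univ_succ, show d + (x 0 + ∑ i : Fin n, x i.succ) =
        x 0 - -(d + ∑ i : Fin n, x i.succ) by ring, hI]
      refine Finset.sum_congr rfl fun k _ => ?_
      rw [Fin.prod_univ_succ]
      simp only [Fin.cons_zero, Fin.cons_succ]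
      rw [show u k - -(d + ∑ i : Fin n, x i.succ) = u k + d + ∑ i : Fin n, x i.succ by ring]
    rw [← hI', vand_succAbove hodd 0 x]
    simp only [Fin.succAbove_zero, Fin.val_zero, pow_zero, one_mul]
    have hv := vand_ne_zero u hu
    field_simp

theorem stmt_3 (N : ℕ) (hN : 2 ≤ N) (r : ℝ) (hr : 0 < r) (δ : ℝ)
    (hδ : ∃ m : ℤ, δ = Real.pi * r * m)
    (τ : ℂ) (hτre : τ.re = 0) (hτim : 0 < τ.im)
    (u : Fin N → ℝ) (hu0 : ∀ j, 0 ≤ u j) (humono : StrictMono u)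
    (hu2 : ∀ j, u j < 2 * Real.pi * r)
    (hubar1 : 0 < δ + ∑ j, u j) (hubar2 : δ + ∑ j, u j < 2 * Real.pi * r)
    (x : Fin N → ℝ) :
    Matrix.det (Matrix.of fun j k : Fin N =>
        (theta1 ((((δ + ∑ i, u i) + x j - u k) / (2 * Real.pi * r) : ℝ)) τ /
            theta1 (((δ + ∑ i, u i) / (2 * Real.pi * r) : ℝ)) τ) *
          ∏ ℓ ∈ Finset.univ.erase k,
            theta1 (((x j - u ℓ) / (2 * Real.pi * r) : ℝ)) τ /
              theta1 (((u k - u ℓ) / (2 * Real.pi * r) : ℝ)) τ) =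
      (theta1 (((δ + ∑ i, x i) / (2 * Real.pi * r) : ℝ)) τ /
          theta1 (((δ + ∑ i, u i) / (2 * Real.pi * r) : ℝ)) τ) *
        ∏ j : Fin N, ∏ k : Fin N, if j < k then
          theta1 (((x j - x k) / (2 * Real.pi * r) : ℝ)) τ /
            theta1 (((u j - u k) / (2 * Real.pi * r) : ℝ)) τ else 1 := by
  set R : ℝ := 2 * Real.pi * r with hR
  set θ : ℂ → ℂ := fun v => theta1 v τ with hθ
  set X : Fin N → ℂ := fun j => (x j : ℂ) / R with hX
  set V : Fin N → ℂ := fun j => (u j : ℂ) / R with hV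
  set U : ℂ := ((δ : ℂ) + ∑ i, (u i : ℂ)) / R with hU
  have c1 : ∀ j k, theta1 (((((δ + ∑ i, u i) + x j - u k) / R : ℝ)) : ℂ) τ =
      θ (U + X j - V k) := by
    intro j k; simp only [hθ, hU, hX, hV]; congr 1; push_cast; ring
  have c2 : theta1 ((((δ + ∑ i, u i) / R : ℝ)) : ℂ) τ = θ U := by
    simp only [hθ, hU]; congr 1; push_cast; ring
  have c3 : ∀ j k, theta1 ((((x j - u k) / R : ℝ)) : ℂ) τ = θ (X j - V k) := by
    intro j k; simp only [hθ, hX, hV]; congr 1; push_cast; ring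
  have c4 : ∀ j k, theta1 ((((u j - u k) / R : ℝ)) : ℂ) τ = θ (V j - V k) := by
    intro j k; simp only [hθ, hV]; congr 1; push_cast; ring
  have c5 : ∀ j k, theta1 ((((x j - x k) / R : ℝ)) : ℂ) τ = θ (X j - X k) := by
    intro j k; simp only [hθ, hX]; congr 1; push_cast; ring
  have c6 : theta1 ((((δ + ∑ i, x i) / R : ℝ)) : ℂ) τ = θ ((δ : ℂ) / R + ∑ i, X i) := by
    simp only [hθ, hX, ← Finset.sum_div]; congr 1; push_cast; ring
  simp only [c1, c2, c3, c4, c5, c6]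
  have hodd : ∀ v, θ (-v) = -θ v := fun v => theta1_odd hτim v
  by_cases hU0 : θ U = 0
  · rw [hU0]
    simp only [div_zero, zero_mul]
    exact Matrix.det_eq_zero_of_row_eq_zero ⟨0, by omega⟩ (fun _ => rfl)
  by_cases hV0 : ∀ k l, k ≠ l → θ (V k - V l) ≠ 0
  · rw [frob (theta1_differentiable hτim) hodd (theta1_three hτim) N (δ / R) U X V
      (by simp only [hU, hV, ← Finset.sum_div]; ring) hU0 hV0]
    congr 1
    rw [vand, vand, ← Finset.prod_div_distrib]
    refine Finset.prod_congr rfl fun j _ => ?_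
    rw [← Finset.prod_div_distrib]
    refine Finset.prod_congr rfl fun k _ => ?_
    by_cases hjk : j < k
    · rw [if_pos hjk, if_pos hjk, if_pos hjk]
    · rw [if_neg hjk, if_neg hjk, if_neg hjk, div_one]
  · push Not at hV0
    obtain ⟨k, l, hkl, h0⟩ := hV0
    rw [Matrix.det_eq_zero_of_column_eq_zero k]
    · symm
      have h0' : θ (V l - V k) = 0 := by rw [← neg_sub, hodd, h0, neg_zero]
      rcases lt_or_gt_of_ne hkl with h | h
      · rw [Finset.prod_eq_zero (Finset.mem_univ k), mul_zero]
        refine Finset.prod_eq_zero (Finset.mem_univ l) ?_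
        rw [if_pos h, h0, div_zero]
      · rw [Finset.prod_eq_zero (Finset.mem_univ l), mul_zero]
        refine Finset.prod_eq_zero (Finset.mem_univ k) ?_
        rw [if_pos h, h0', div_zero]
    · intro j
      rw [Matrix.of_apply, Finset.prod_eq_zero (Finset.mem_erase.2 ⟨hkl.symm, Finset.mem_univ l⟩),
        mul_zero]
      rw [h0, div_zero]
end

section
/- Let N ≥ 2, r > 0, 0 < t* < ∞. Take the equidistant configuration u_k = v_k := 2πr(k−1)/N (1 ≤ k ≤ N) and δ = −πr(N−2), so that ū_δ := δ + Σ_{j=1}^N v_j = πr. Then Φ^A_{v,δ,k}(v_j) = δ_{jk} (Kronecker delta) for all 1 ≤ j, k ≤ N. -/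
/-- The entire function `Φ^A_{u,δ,k}(z)` built from Jacobi theta functions with
nome parameter `τ = i N t* / (2π r²)`. -/
noncomputable def PhiA (N : ℕ) (r tstar : ℝ) (u : Fin N → ℝ) (δ : ℝ) (k : Fin N)
    (z : ℂ) : ℂ :=
  theta1 ((((δ + ∑ i, u i : ℝ) : ℂ) + z - ((u k : ℝ) : ℂ)) / (2 * Real.pi * r))
      (Complex.I * N * tstar / (2 * Real.pi * r ^ 2)) /
    theta1 (((δ + ∑ i, u i : ℝ) : ℂ) / (2 * Real.pi * r))
      (Complex.I * N * tstar / (2 * Real.pi * r ^ 2)) *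
  ∏ ℓ ∈ Finset.univ.erase k,
    theta1 ((z - ((u ℓ : ℝ) : ℂ)) / (2 * Real.pi * r))
        (Complex.I * N * tstar / (2 * Real.pi * r ^ 2)) /
      theta1 ((((u k - u ℓ) : ℝ) : ℂ) / (2 * Real.pi * r))
        (Complex.I * N * tstar / (2 * Real.pi * r ^ 2))

open Complex in
lemma aux_cos_bound (w : ℂ) : ‖Complex.cos w‖ ≤ Real.exp |w.im| := by
  unfold Complex.cos
  have h1 : ‖cexp (w * I)‖ ≤ Real.exp |w.im| := by
    rw [Complex.norm_exp]
    apply Real.exp_le_exp.mpr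
    simpa using neg_le_abs w.im
  have h2 : ‖cexp (-w * I)‖ ≤ Real.exp |w.im| := by
    rw [Complex.norm_exp]
    apply Real.exp_le_exp.mpr
    simpa using le_abs_self w.im
  rw [norm_div]
  have := norm_add_le (cexp (w * I)) (cexp (-w * I))
  simp only [Complex.norm_ofNat]
  linarith

open Complex in
lemma aux_sin_bound (y : ℂ) (n : ℕ) :
    ‖Complex.sin ((2 * n + 1) * y)‖ ≤ (2 * n + 1) * Real.exp (2 * n * |y.im|) * ‖Complex.sin y‖ := by
  induction n with
  | zero => simp
  | succ n ih =>
    have e : Complex.sin ((2 * ((n + 1 : ℕ) : ℂ) + 1) * y) =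
        Complex.sin ((2 * n + 1) * y) + 2 * Complex.cos ((2 * n + 2) * y) * Complex.sin y := by
      have a1 : (2 * ((n + 1 : ℕ) : ℂ) + 1) * y = (2 * n + 2) * y + y := by push_cast; ring
      have a2 : (2 * (n : ℂ) + 1) * y = (2 * n + 2) * y - y := by ring
      rw [a1, a2, Complex.sin_add, Complex.sin_sub]; ring
    have hc := aux_cos_bound ((2 * n + 2) * y)
    have him : |((2 * (n : ℂ) + 2) * y).im| = (2 * n + 2) * |y.im| := by
      have : ((2 * (n : ℂ) + 2) * y).im = (2 * n + 2) * y.im := by simp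
      rw [this, abs_mul, abs_of_nonneg (by positivity)]
    rw [him] at hc
    have hm : Real.exp (2 * n * |y.im|) ≤ Real.exp ((2 * n + 2) * |y.im|) := by
      apply Real.exp_le_exp.mpr
      nlinarith [abs_nonneg y.im]
    rw [e]
    refine (norm_add_le _ _).trans ?_
    rw [norm_mul, norm_mul, Complex.norm_ofNat]
    have h1 : (2 * (n : ℝ) + 1) * Real.exp (2 * n * |y.im|) * ‖Complex.sin y‖ ≤
       (2 * (n : ℝ) + 1) * Real.exp ((2 * n + 2) * |y.im|) * ‖Complex.sin y‖ := by gcongr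
    have h2 : 2 * ‖Complex.cos ((2 * n + 2) * y)‖ * ‖Complex.sin y‖ ≤
       2 * Real.exp ((2 * n + 2) * |y.im|) * ‖Complex.sin y‖ := by gcongr
    push_cast
    have e3 : 2 * ((n : ℝ) + 1) * |y.im| = (2 * n + 2) * |y.im| := by ring
    rw [e3]
    linarith

open Complex in
lemma aux_term (v τ : ℂ) (n : ℤ) : (-1 : ℂ) ^ n *
    Complex.exp (Real.pi * Complex.I * τ * ((n : ℂ) - 1 / 2) ^ 2) *
    Complex.exp (Real.pi * Complex.I * (2 * (n : ℂ) - 1) * v) =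
    cexp (Real.pi * I * τ / 4 - Real.pi * I * v) * jacobiTheta₂_term n (v + 1 / 2 - τ / 2) τ := by
  rw [← Complex.exp_pi_mul_I, ← Complex.exp_int_mul, jacobiTheta₂_term, ← Complex.exp_add,
    ← Complex.exp_add, ← Complex.exp_add]
  congr 1
  ring

open Complex in
lemma aux_theta1 (v τ : ℂ) : theta1 v τ =
    I * (cexp (Real.pi * I * τ / 4 - Real.pi * I * v) * jacobiTheta₂ (v + 1 / 2 - τ / 2) τ) := by
  unfold theta1
  simp_rw [aux_term]
  rw [tsum_mul_left, jacobiTheta₂]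

lemma aux_theta1_ne_iff (v τ : ℂ) : theta1 v τ = 0 ↔ jacobiTheta₂ (v + 1 / 2 - τ / 2) τ = 0 := by
  rw [aux_theta1]; simp [Complex.exp_ne_zero]

lemma aux_theta1_add_one (v τ : ℂ) : theta1 (v + 1) τ = 0 ↔ theta1 v τ = 0 := by
  rw [aux_theta1_ne_iff, aux_theta1_ne_iff, ← jacobiTheta₂_add_left (v + 1 / 2 - τ / 2)]
  rw [show v + 1 + 1 / 2 - τ / 2 = v + 1 / 2 - τ / 2 + 1 by ring]

open Complex in
lemma aux_theta1_inv (v τ : ℂ) (hτ : 0 < τ.im) :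
    theta1 v τ = 0 ↔ theta1 (v / τ) (-1 / τ) = 0 := by
  have h0 : τ ≠ 0 := by rintro rfl; simp at hτ
  rw [aux_theta1_ne_iff, aux_theta1_ne_iff, jacobiTheta₂_functional_equation]
  rw [← jacobiTheta₂_add_left ((v + 1 / 2 - τ / 2) / τ),
    show (v + 1 / 2 - τ / 2) / τ + 1 = v / τ + 1 / 2 - -1 / τ / 2 by field_simp; ring]
  have : (-I * τ) ^ (1 / 2 : ℂ) ≠ 0 := by
    rw [Ne, Complex.cpow_eq_zero_iff]; simp [h0]
  simp [Complex.exp_ne_zero, h0]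

open Complex in
lemma aux_hasSum (v τ : ℂ) (hτ : 0 < τ.im) (h : theta1 v τ = 0) :
    HasSum (fun n : ℕ => (-1 : ℂ) ^ n * cexp (Real.pi * I * τ * (n + 1 / 2) ^ 2) *
      Complex.sin ((2 * n + 1) * (Real.pi * v))) 0 := by
  have h1 := (hasSum_jacobiTheta₂_term (v + 1 / 2 - τ / 2) hτ).mul_left
    (cexp (Real.pi * I * τ / 4 - Real.pi * I * v))
  rw [(aux_theta1_ne_iff _ _).mp h, mul_zero] at h1
  simp_rw [← aux_term] at h1
  have h2 := ((Equiv.neg ℤ).hasSum_iff.mpr h1).nat_add_neg_add_one.mul_left (I / 2)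
  rw [mul_zero] at h2
  refine Eq.subst (motive := fun g : ℕ → ℂ => HasSum g 0) (funext fun n => Eq.symm ?_) h2
  simp only [Function.comp, Equiv.neg_apply, neg_neg]
  have e1 : (-1 : ℂ) ^ (-(n : ℤ)) = (-1) ^ n := by
    rw [zpow_neg, zpow_natCast, ← inv_pow]; norm_num
  have e2 : (-1 : ℂ) ^ ((n : ℤ) + 1) = -(-1) ^ n := by
    rw [zpow_add₀ (by norm_num), zpow_natCast]; simp
  rw [e1, e2]
  push_cast
  rw [show (-(n : ℂ) - 1 / 2) ^ 2 = (n + 1 / 2) ^ 2 by ring,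
    show ((n : ℂ) + 1 - 1 / 2) ^ 2 = (n + 1 / 2) ^ 2 by ring]
  rw [Complex.sin]
  rw [show -((2 * (n : ℂ) + 1) * (Real.pi * v)) * I = Real.pi * I * (2 * -(n : ℂ) - 1) * v by ring,
    show (2 * (n : ℂ) + 1) * (Real.pi * v) * I = Real.pi * I * (2 * ((n : ℂ) + 1) - 1) * v by ring]
  ring

open Complex in
lemma aux_large (s : ℝ) (hs : 1 ≤ s) (v : ℂ) (hv : |v.im| ≤ s / 2)
    (hsin : Complex.sin (Real.pi * v) ≠ 0) : theta1 v (I * s) ≠ 0 := by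
  intro h
  have hS := aux_hasSum v (I * s) (by simp; linarith) h
  set f : ℕ → ℂ := fun n => (-1 : ℂ) ^ n * cexp (Real.pi * I * (I * s) * (n + 1 / 2) ^ 2) *
      Complex.sin ((2 * n + 1) * (Real.pi * v)) with hf
  have hn : ∀ n : ℕ, ‖f n‖ = Real.exp (-(Real.pi * s * (n + 1 / 2) ^ 2)) *
      ‖Complex.sin ((2 * n + 1) * (Real.pi * v))‖ := by
    intro n
    have : (Real.pi * I * (I * s) * (n + 1 / 2) ^ 2 : ℂ) =
        ((-(Real.pi * s * (n + 1 / 2) ^ 2) : ℝ) : ℂ) := by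
      push_cast
      linear_combination (Real.pi * s * ((n : ℂ) + 1 / 2) ^ 2) * I_mul_I
    simp only [hf]
    rw [norm_mul, norm_mul, norm_pow, norm_neg, norm_one, one_pow, one_mul, this,
      Complex.norm_exp_ofReal]
  have h0 : 0 < ‖f 0‖ := by
    rw [hn]
    have : 0 < ‖Complex.sin (Real.pi * v)‖ := norm_pos_iff.mpr hsin
    simpa using mul_pos (Real.exp_pos _) this
  have hpi : Real.exp (-Real.pi) ≤ 1 / 10 := by
    rw [Real.exp_neg, one_div]
    apply inv_anti₀ (by norm_num)
    have h3 : Real.exp 3 ≤ Real.exp Real.pi := Real.exp_le_exp.mpr Real.pi_gt_three.le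
    have h4 : Real.exp 3 = Real.exp 1 ^ 3 := by rw [← Real.exp_nat_mul]; norm_num
    have h5 : (2.7 : ℝ) ^ 3 ≤ Real.exp 1 ^ 3 := by
      gcongr
      linarith [Real.exp_one_gt_d9]
    norm_num at h5
    linarith
  have hb : ∀ n : ℕ, ‖f (n + 1)‖ ≤ ‖f 0‖ * (3 / 10) * (1 / 5) ^ n := by
    intro n
    have hsb := aux_sin_bound (Real.pi * v) (n + 1)
    have him : |((Real.pi : ℂ) * v).im| ≤ Real.pi * (s / 2) := by
      have : ((Real.pi : ℂ) * v).im = Real.pi * v.im := by simp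
      rw [this, abs_mul, abs_of_pos Real.pi_pos]
      have := Real.pi_pos
      gcongr
    rw [hn, hn]
    have hp := Real.pi_pos
    have hE : Real.exp (-(Real.pi * s * (((n + 1 : ℕ) : ℝ) + 1 / 2) ^ 2)) *
        Real.exp (2 * ((n + 1 : ℕ) : ℝ) * |((Real.pi : ℂ) * v).im|) ≤
        Real.exp (-(Real.pi * s * (((0 : ℕ) : ℝ) + 1 / 2) ^ 2)) * (1 / 10) ^ (n + 1) := by
      have : Real.exp (-Real.pi) ^ (n + 1) ≤ (1 / 10) ^ (n + 1) := by gcongr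
      refine le_trans ?_ (mul_le_mul_of_nonneg_left this (Real.exp_pos _).le)
      rw [← Real.exp_nat_mul, ← Real.exp_add, ← Real.exp_add]
      apply Real.exp_le_exp.mpr
      have m1 : 2 * ((n + 1 : ℕ) : ℝ) * |((Real.pi : ℂ) * v).im| ≤
        2 * ((n + 1 : ℕ) : ℝ) * (Real.pi * (s / 2)) := by gcongr
      have m2 : ((n : ℝ) + 1) * Real.pi ≤ Real.pi * s * ((n : ℝ) + 1) ^ 2 := by
        have : (n : ℝ) + 1 ≤ s * ((n : ℝ) + 1) ^ 2 := by
          have hn0 : (0 : ℝ) ≤ n := Nat.cast_nonneg n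
          nlinarith [mul_nonneg (sub_nonneg.mpr hs) (sq_nonneg ((n : ℝ) + 1))]
        nlinarith
      push_cast at m1 ⊢
      nlinarith
    have h3 : (2 * ((n + 1 : ℕ) : ℝ) + 1) ≤ 3 * 2 ^ n := by
      clear * -
      induction n with
      | zero => norm_num
      | succ n ih =>
        have : (1 : ℝ) ≤ 2 ^ n := one_le_pow₀ (by norm_num)
        push_cast at ih ⊢
        rw [pow_succ]; linarith
    calc _ ≤ Real.exp (-(Real.pi * s * (((n + 1 : ℕ) : ℝ) + 1 / 2) ^ 2)) *
          ((2 * ((n + 1 : ℕ) : ℝ) + 1) * Real.exp (2 * ((n + 1 : ℕ) : ℝ) *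
          |((Real.pi : ℂ) * v).im|) * ‖Complex.sin (Real.pi * v)‖) := by gcongr
      _ = (Real.exp (-(Real.pi * s * (((n + 1 : ℕ) : ℝ) + 1 / 2) ^ 2)) *
        Real.exp (2 * ((n + 1 : ℕ) : ℝ) * |((Real.pi : ℂ) * v).im|)) *
          (2 * ((n + 1 : ℕ) : ℝ) + 1) * ‖Complex.sin (Real.pi * v)‖ := by ring
      _ ≤ (Real.exp (-(Real.pi * s * (((0 : ℕ) : ℝ) + 1 / 2) ^ 2)) * (1 / 10) ^ (n + 1)) *
          (3 * 2 ^ n) * ‖Complex.sin (Real.pi * v)‖ := by gcongr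
      _ = _ := by
        have : (1 / 5 : ℝ) ^ n = (1 / 10) ^ n * 2 ^ n := by rw [← mul_pow]; norm_num
        rw [this]
        simp only [Nat.cast_zero, mul_zero, zero_add, one_mul]
        ring
  have hg : HasSum (fun n : ℕ => ‖f 0‖ * (3 / 10) * (1 / 5 : ℝ) ^ n)
      (‖f 0‖ * (3 / 10) * (1 - 1 / 5)⁻¹) :=
    (hasSum_geometric_of_lt_one (by norm_num) (by norm_num)).mul_left _
  have ht := (hasSum_nat_add_iff' 1).mpr hS
  have hle := tsum_of_norm_bounded hg hb
  rw [ht.tsum_eq] at hle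
  simp only [Finset.sum_range_one, zero_sub, norm_neg] at hle
  norm_num at hle
  linarith

open Complex in
lemma aux_sin_ne (z : ℂ) (h : ∀ n : ℤ, z ≠ n) : Complex.sin (Real.pi * z) ≠ 0 := by
  rw [Complex.sin_ne_zero_iff]
  intro k hk
  apply h k
  have : (Real.pi : ℂ) ≠ 0 := by exact_mod_cast Real.pi_ne_zero
  rw [mul_comm] at hk
  exact mul_right_cancel₀ this hk

open Complex in
lemma aux_half (s : ℝ) (hs : 0 < s) (x : ℝ) (hx : x ≠ 0) (hx2 : |x| ≤ 1 / 2) :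
    theta1 (x : ℂ) (I * s) ≠ 0 := by
  rcases le_total 1 s with h1 | h1
  · apply aux_large s h1
    · simp; linarith
    · apply aux_sin_ne
      intro n hn
      have hn' : x = n := by exact_mod_cast hn
      rw [hn'] at hx hx2
      have h3 : n ≠ 0 := by rintro rfl; simp at hx
      have h4 : (1 : ℝ) ≤ |(n : ℝ)| := by exact_mod_cast Int.one_le_abs h3
      linarith
  · have hs0 : (s : ℂ) ≠ 0 := by exact_mod_cast hs.ne'
    rw [Ne, aux_theta1_inv _ _ (by simpa using hs)]
    rw [show -1 / (I * s) = I * ((s⁻¹ : ℝ) : ℂ) by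
      push_cast; field_simp; rw [I_sq]]
    have e : (x : ℂ) / (I * s) = ((-(x / s) : ℝ) : ℂ) * I := by
      push_cast; field_simp; rw [I_sq]; ring
    rw [e]
    apply aux_large
    · exact (one_le_inv₀ hs).mpr h1
    · simp only [mul_im, ofReal_re, ofReal_im, I_re, I_im]
      simp only [mul_one, mul_zero, add_zero, abs_neg, abs_div, abs_of_pos hs]
      rw [div_le_iff₀ hs]
      field_simp
      linarith
    · apply aux_sin_ne
      intro n hn
      have := congrArg Complex.im hn
      simp [hx, hs.ne'] at this

open Complex in
lemma aux_ne (s : ℝ) (hs : 0 < s) (x : ℝ) (hx : x ≠ 0) (hx2 : |x| < 1) :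
    theta1 (x : ℂ) (I * s) ≠ 0 := by
  rw [abs_lt] at hx2
  by_cases h : |x| ≤ 1 / 2
  · exact aux_half s hs x hx h
  · rw [not_le, lt_abs] at h
    rcases h with h | h
    · have := aux_half s hs (x - 1) (by linarith) (by rw [abs_le]; constructor <;> linarith)
      rw [Ne, ← aux_theta1_add_one] at this
      simpa using this
    · have := aux_half s hs (x + 1) (by linarith) (by rw [abs_le]; constructor <;> linarith)
      push_cast at this
      rwa [Ne, aux_theta1_add_one] at this

open Complex in
lemma aux_zero (τ : ℂ) : theta1 0 τ = 0 := by
  rw [aux_theta1_ne_iff]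
  have h1 := jacobiTheta₂_add_left' (1 / 2 - τ / 2) τ
  have h2 := jacobiTheta₂_neg_left (1 / 2 - τ / 2) τ
  have h3 := jacobiTheta₂_add_left (-(1 / 2 - τ / 2)) τ
  rw [show -(1 / 2 - τ / 2) + 1 = 1 / 2 - τ / 2 + τ by ring, h2, h1] at h3
  rw [show -Real.pi * I * (τ + 2 * (1 / 2 - τ / 2)) = -(Real.pi * I) by ring, Complex.exp_neg,
    Complex.exp_pi_mul_I] at h3
  rw [zero_add]
  norm_num at h3
  linear_combination (-1 / 2) * h3

theorem stmt_9 (N : ℕ) (hN : 2 ≤ N) (r tstar : ℝ) (hr : 0 < r) (ht : 0 < tstar)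
    (j k : Fin N) :
    PhiA N r tstar (fun i => 2 * Real.pi * r * (i : ℕ) / N)
        (-(Real.pi * r * ((N : ℝ) - 2))) k
        (((2 * Real.pi * r * (j : ℕ) / N : ℝ)) : ℂ) = if j = k then 1 else 0 := by
  have hN0 : (0 : ℝ) < N := by exact_mod_cast (by omega : 0 < N)
  have hp := Real.pi_pos
  have hτ : Complex.I * N * tstar / (2 * Real.pi * r ^ 2) =
      Complex.I * ((N * tstar / (2 * Real.pi * r ^ 2) : ℝ) : ℂ) := by
    push_cast; ring
  have hs : 0 < N * tstar / (2 * Real.pi * r ^ 2) := by positivity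
  unfold PhiA
  rw [hτ]
  set s := N * tstar / (2 * Real.pi * r ^ 2)
  have hsum : -(Real.pi * r * ((N : ℝ) - 2)) + ∑ i : Fin N, 2 * Real.pi * r * (i : ℕ) / N
      = Real.pi * r := by
    have e : ∑ i : Fin N, 2 * Real.pi * r * ((i : ℕ) : ℝ) / N =
        2 * Real.pi * r / N * ∑ i ∈ Finset.range N, (i : ℝ) := by
      rw [Fin.sum_univ_eq_sum_range (fun i => 2 * Real.pi * r * (i : ℝ) / N) N, Finset.mul_sum]
      exact Finset.sum_congr rfl fun i _ => by ring
    have g : ∑ i ∈ Finset.range N, (i : ℝ) = N * (N - 1) / 2 := by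
      clear * -
      induction N with
      | zero => simp
      | succ n ih => rw [Finset.sum_range_succ, ih]; push_cast; ring
    rw [e, g]
    field_simp
    ring
  simp only [hsum]
  split_ifs with hjk
  · subst hjk
    rw [add_sub_cancel_right, div_self, one_mul]
    · apply Finset.prod_eq_one
      intro l hl
      rw [← Complex.ofReal_sub, div_self]
      have hlj : (l : ℕ) ≠ (j : ℕ) := fun h => (Finset.mem_erase.mp hl).1 (Fin.ext h)
      have hx : (((2 * Real.pi * r * (j : ℕ) / N - 2 * Real.pi * r * (l : ℕ) / N : ℝ) : ℂ))
          / (2 * Real.pi * r) = (((((j : ℕ) : ℝ) - (l : ℕ)) / N : ℝ) : ℂ) := by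
        have : (2 * Real.pi * r * (j : ℕ) / N - 2 * Real.pi * r * (l : ℕ) / N) / (2 * Real.pi * r)
          = (((j : ℕ) : ℝ) - (l : ℕ)) / N := by field_simp
        rw [← this]; push_cast; rfl
      rw [hx]
      apply aux_ne s hs
      · apply div_ne_zero _ hN0.ne'
        rw [sub_ne_zero]
        exact_mod_cast hlj.symm
      · have hj : ((j : ℕ) : ℝ) < N := by exact_mod_cast j.2
        have hl : ((l : ℕ) : ℝ) < N := by exact_mod_cast l.2
        have hj0 : (0 : ℝ) ≤ ((j : ℕ) : ℝ) := Nat.cast_nonneg _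
        have hl0 : (0 : ℝ) ≤ ((l : ℕ) : ℝ) := Nat.cast_nonneg _
        rw [abs_div, abs_of_pos hN0, div_lt_one hN0, abs_lt]
        constructor <;> linarith
    · have : ((Real.pi * r : ℝ) : ℂ) / (2 * Real.pi * r) = ((1 / 2 : ℝ) : ℂ) := by
        have : (Real.pi * r) / (2 * Real.pi * r) = 1 / 2 := by field_simp
        rw [← this]; push_cast; rfl
      rw [this]
      apply aux_ne s hs
      · norm_num
      · rw [abs_of_pos] <;> norm_num
  · rw [Finset.prod_eq_zero (i := j), mul_zero]
    · simp [hjk]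
    · rw [sub_self, zero_div, aux_zero, zero_div]
end

section
/- Let N ≥ 2, r > 0, 0 < t* < ∞. Take the equidistant configuration u_k = v_k := 2πr(k−1)/N (1 ≤ k ≤ N) and δ = −πr(N−2). Then for every 1 ≤ k ≤ N, every 0 < s < t < t*, and every x ∈ ℝ: ∫_ℝ M^A_{v,δ,k}(t, w) · (1/√(2π(t−s)))·e^{−(w−x)²/(2(t−s))} dw = M^A_{v,δ,k}(s, x). -/
/-- `M^A_{u,δ,k}(t,x) = ∫_ℝ (e^{-w²/(2t)}/√(2πt)) Φ^A_{u,δ,k}(x + iw) dw`. -/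
noncomputable def MA (N : ℕ) (r tstar : ℝ) (u : Fin N → ℝ) (δ : ℝ) (k : Fin N)
    (t x : ℝ) : ℂ :=
  ∫ w : ℝ, ((Real.exp (-w ^ 2 / (2 * t)) / Real.sqrt (2 * Real.pi * t) : ℝ) : ℂ) *
    PhiA N r tstar u δ k ((x : ℂ) + Complex.I * w)

open MeasureTheory

noncomputable def gk (v μ w : ℝ) : ℝ :=
  Real.exp (-(w - μ) ^ 2 / (2 * v)) / Real.sqrt (2 * Real.pi * v)

lemma gk_nonneg (v μ w : ℝ) : 0 ≤ gk v μ w := by unfold gk; positivity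

lemma gk_eq (v : ℝ) (hv : 0 < v) (μ w : ℝ) :
    gk v μ w = ProbabilityTheory.gaussianPDFReal μ ⟨v, hv.le⟩ w := by
  unfold gk ProbabilityTheory.gaussianPDFReal
  rw [div_eq_inv_mul]; rfl

lemma gk_integral (v : ℝ) (hv : 0 < v) (μ : ℝ) (z : ℂ) :
    ∫ w : ℝ, (gk v μ w : ℂ) * Complex.exp (z * w) = Complex.exp (z * μ + v * z ^ 2 / 2) := by
  have hv' : (⟨v, hv.le⟩ : NNReal) ≠ 0 := by
    intro h; exact hv.ne' (congrArg NNReal.toReal h)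
  have h := ProbabilityTheory.complexMGF_id_gaussianReal (μ := μ) (v := ⟨v, hv.le⟩) z
  rw [ProbabilityTheory.complexMGF,
    ProbabilityTheory.integral_gaussianReal_eq_integral_smul hv'] at h
  simp only [id, Complex.real_smul, ← gk_eq v hv] at h
  exact h

lemma gk_integrable (v : ℝ) (hv : 0 < v) (μ : ℝ) (z : ℂ) :
    Integrable (fun w : ℝ => (gk v μ w : ℂ) * Complex.exp (z * w)) := by
  by_contra hc
  have h := gk_integral v hv μ z
  rw [integral_undef hc] at h
  exact Complex.exp_ne_zero _ h.symm

lemma gk_norm (v μ w : ℝ) (z : ℂ) :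
    ‖(gk v μ w : ℂ) * Complex.exp (z * w)‖ = gk v μ w * Real.exp (z.re * w) := by
  rw [norm_mul, Complex.norm_exp, Complex.norm_real, Real.norm_of_nonneg (gk_nonneg _ _ _)]
  simp

lemma gk_norm_integral (v : ℝ) (hv : 0 < v) (μ : ℝ) (z : ℂ) :
    ∫ w : ℝ, ‖(gk v μ w : ℂ) * Complex.exp (z * w)‖
      = Real.exp (z.re * μ + v * z.re ^ 2 / 2) := by
  simp_rw [gk_norm]
  have h := gk_integral v hv μ z.re
  apply Complex.ofReal_injective
  rw [← integral_complex_ofReal]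
  push_cast
  exact h

lemma gk_series {ι : Type} [Countable ι] (c z : ι → ℂ) (v : ℝ) (hv : 0 < v) (μ : ℝ)
    (hs : Summable fun i => ‖c i‖ * Real.exp ((z i).re * μ + v * (z i).re ^ 2 / 2)) :
    ∫ w : ℝ, (gk v μ w : ℂ) * ∑' i, c i * Complex.exp (z i * w)
      = ∑' i, c i * Complex.exp (z i * μ + v * (z i) ^ 2 / 2) := by
  have key := integral_tsum_of_summable_integral_norm (μ := (volume : Measure ℝ))
    (F := fun i (w : ℝ) => c i * ((gk v μ w : ℂ) * Complex.exp (z i * w)))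
    (fun i => (gk_integrable v hv μ (z i)).const_mul _)
    (by
      simp_rw [norm_mul (c _), integral_const_mul, gk_norm_integral v hv]
      exact hs)
  simp_rw [integral_const_mul, gk_integral v hv] at key
  rw [key]
  congr 1; ext w
  rw [← tsum_mul_left]
  congr 1; ext i; ring

def ExpRep (β m : ℝ) (f : ℂ → ℂ) : Prop :=
  ∃ (ι : Type) (_ : Countable ι) (c : ι → ℂ) (l E : ι → ℝ),
    (∀ i, 0 ≤ E i) ∧ (∀ i, l i ^ 2 ≤ m * E i) ∧
    (Summable fun i => ‖c i‖ * Real.exp (β * E i)) ∧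
    ∀ z : ℂ, (Summable fun i => ‖c i * Complex.exp (Complex.I * l i * z)‖) ∧
      f z = ∑' i, c i * Complex.exp (Complex.I * l i * z)

lemma ExpRep.const (β : ℝ) (K : ℂ) : ExpRep β 0 (fun _ => K) := by
  refine ⟨Unit, inferInstance, fun _ => K, fun _ => 0, fun _ => 0, ?_, ?_, ?_, ?_⟩
  · simp
  · simp
  · exact Summable.of_finite
  · intro z
    exact ⟨Summable.of_finite, by simp⟩

lemma ExpRep.mul {β m n : ℝ} (hm : 0 ≤ m) (hn : 0 ≤ n) {f g : ℂ → ℂ} (hf : ExpRep β m f)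
    (hg : ExpRep β n g) : ExpRep β (m + n) (fun z => f z * g z) := by
  obtain ⟨ι, _, c, l, E, h0, h1, h2, h3⟩ := hf
  obtain ⟨κ, _, d, k, F, g0, g1, g2, g3⟩ := hg
  have e : ∀ z : ℂ, (fun p : ι × κ => c p.1 * d p.2 *
      Complex.exp (Complex.I * ((l p.1 + k p.2 : ℝ) : ℂ) * z)) = fun p =>
      (c p.1 * Complex.exp (Complex.I * l p.1 * z)) *
      (d p.2 * Complex.exp (Complex.I * k p.2 * z)) := by
    intro z; ext p
    rw [show Complex.I * ((l p.1 + k p.2 : ℝ) : ℂ) * z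
      = Complex.I * l p.1 * z + Complex.I * k p.2 * z by push_cast; ring, Complex.exp_add]
    ring
  refine ⟨ι × κ, inferInstance, fun p => c p.1 * d p.2, fun p => l p.1 + k p.2,
    fun p => E p.1 + F p.2, fun p => add_nonneg (h0 _) (g0 _), ?_, ?_, ?_⟩
  · rintro ⟨i, j⟩
    dsimp only
    have a1 := h1 i
    have a2 := g1 j
    have b1 := h0 i
    have b2 := g0 j
    have hp : (l i * k j) ^ 2 ≤ (m * F j) * (n * E i) := by
      calc (l i * k j) ^ 2 = l i ^ 2 * k j ^ 2 := by ring
        _ ≤ (m * E i) * (n * F j) := by gcongr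
        _ = _ := by ring
    have hq : 2 * (l i * k j) ≤ m * F j + n * E i := by
      have p1 : 0 ≤ m * F j := by positivity
      have p2 : 0 ≤ n * E i := by positivity
      refine abs_le_of_sq_le_sq' ?_ (by positivity) |>.2
      nlinarith [sq_nonneg (m * F j - n * E i)]
    nlinarith
  · have := h2.mul_of_nonneg g2 (fun i => by positivity) (fun i => by positivity)
    refine this.congr ?_
    rintro ⟨i, j⟩
    simp only [norm_mul, mul_add, Real.exp_add]
    ring
  · intro z
    obtain ⟨s1, e1⟩ := h3 z
    obtain ⟨s2, e2⟩ := g3 z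
    have hh := summable_mul_of_summable_norm s1 s2
    constructor
    · refine (s1.mul_norm s2).congr fun p => ?_
      exact congrArg norm (congrFun (e z) p).symm
    · have := tsum_mul_tsum_of_summable_norm s1 s2
      dsimp only
      rw [e1, e2, this]
      exact tsum_congr fun p => (congrFun (e z) p).symm

lemma summable_shift (a b : ℝ) (ha : 0 < a) :
    Summable fun n : ℤ => Real.exp (-a * ((n : ℝ) - 1 / 2) ^ 2 + b * ((n : ℝ) - 1 / 2)) := by
  have h := ((summable_jacobiTheta₂_term_iff
    (((-(a + b) / (2 * Real.pi) : ℝ) : ℂ) * Complex.I)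
    (((a / Real.pi : ℝ) : ℂ) * Complex.I)).2 (by simp; positivity)).norm
  simp_rw [norm_jacobiTheta₂_term] at h
  refine (h.mul_left (Real.exp (-a / 4 - b / 2))).congr ?_
  intro n
  rw [← Real.exp_add]
  congr 1
  simp only [Complex.mul_im, Complex.ofReal_re, Complex.ofReal_im, Complex.I_re, Complex.I_im]
  field_simp
  ring

lemma ExpRep.theta (β r A : ℝ) (hr : 0 < r) (hA : β / r ^ 2 < Real.pi * A) (hA0 : 0 < A) (d : ℝ) :
    ExpRep β 1 (fun z => theta1 ((z - d) / (2 * Real.pi * r)) (Complex.I * A)) := by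
  have hpi := Real.pi_pos
  have hr' : (r : ℂ) ≠ 0 := by exact_mod_cast hr.ne'
  have hpi' : (Real.pi : ℂ) ≠ 0 := by exact_mod_cast hpi.ne'
  set c : ℤ → ℂ := fun n => Complex.I * ((-1 : ℂ) ^ n *
    Complex.exp (((-(Real.pi * A) * ((n : ℝ) - 1 / 2) ^ 2 : ℝ) : ℂ)) *
    Complex.exp (((-(((n : ℝ) - 1 / 2) / r * d) : ℝ) : ℂ) * Complex.I)) with hc
  have hcn : ∀ n, ‖c n‖ = Real.exp (-(Real.pi * A) * ((n : ℝ) - 1 / 2) ^ 2) := by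
    intro n
    rw [hc]
    simp only [norm_mul, Complex.norm_exp_ofReal_mul_I, Complex.norm_I, norm_zpow, norm_neg,
      norm_one, one_zpow, one_mul, mul_one]
    rw [← Complex.ofReal_exp, Complex.norm_real, Real.norm_of_nonneg (Real.exp_pos _).le]
  refine ⟨ℤ, inferInstance, c, fun n => ((n : ℝ) - 1 / 2) / r, fun n => ((n : ℝ) - 1 / 2) ^ 2 / r ^ 2,
    fun n => by positivity, ?_, ?_, ?_⟩
  · intro n
    rw [div_pow, one_mul]
  · refine (summable_shift (Real.pi * A - β / r ^ 2) 0 (by linarith)).congr ?_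
    intro n
    rw [hcn, ← Real.exp_add]
    congr 1
    ring
  · intro z
    constructor
    · refine (summable_shift (Real.pi * A) (-z.im / r) (by positivity)).congr ?_
      intro n
      rw [norm_mul, hcn, Complex.norm_exp, ← Real.exp_add]
      congr 1
      simp
      ring
    · dsimp only
      rw [theta1, ← tsum_mul_left]
      congr 1; ext n
      rw [hc]
      simp only [mul_assoc]
      congr 2
      rw [← Complex.exp_add, ← Complex.exp_add, ← Complex.exp_add]
      congr 1
      push_cast
      field_simp
      ring_nf
      simp only [Complex.I_sq]
      ring

lemma ExpRep.prod {N : ℕ} {β : ℝ} (S : Finset (Fin N)) (f : Fin N → ℂ → ℂ)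
    (hf : ∀ i, ExpRep β 1 (f i)) : ExpRep β (S.card : ℝ) (fun z => ∏ i ∈ S, f i z) := by
  induction S using Finset.induction_on with
  | empty => simpa using ExpRep.const β 1
  | insert a S ha ih =>
    have := ExpRep.mul zero_le_one (Nat.cast_nonneg _) (hf a) ih
    rw [Finset.card_insert_of_notMem ha]
    simp_rw [Finset.prod_insert ha]
    push_cast
    rwa [add_comm]

lemma PhiA_rep (N : ℕ) (hN : 2 ≤ N) (r tstar : ℝ) (hr : 0 < r) (htstar : 0 < tstar)
    (u : Fin N → ℝ) (δ : ℝ) (k : Fin N) (t : ℝ) (ht : t < tstar) :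
    ExpRep (N * t / 2) N (PhiA N r tstar u δ k) := by
  have hN0 : (0 : ℝ) < N := by exact_mod_cast (by omega : 0 < N)
  have hpi := Real.pi_pos
  set A : ℝ := N * tstar / (2 * Real.pi * r ^ 2) with hA
  have hA0 : 0 < A := by positivity
  have hAA : N * t / 2 / r ^ 2 < Real.pi * A := by
    have : Real.pi * A = N * tstar / 2 / r ^ 2 := by rw [hA]; field_simp
    rw [this]
    gcongr
  have hτ : Complex.I * N * tstar / (2 * Real.pi * r ^ 2) = Complex.I * (A : ℂ) := by
    rw [hA]; push_cast; ring
  have hth := ExpRep.theta (N * t / 2) r A hr hAA hA0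
  have h1 := hth (u k - (δ + ∑ i, u i))
  have h2 := ExpRep.prod (Finset.univ.erase k) _ (fun l => hth (u l))
  have h3 := ExpRep.mul le_rfl (by positivity)
    (ExpRep.const (N * t / 2) ((theta1 (((δ + ∑ i, u i : ℝ) : ℂ) / (2 * Real.pi * r))
      (Complex.I * A))⁻¹ * (∏ ℓ ∈ Finset.univ.erase k,
      theta1 ((((u k - u ℓ) : ℝ) : ℂ) / (2 * Real.pi * r)) (Complex.I * A))⁻¹))
      (ExpRep.mul zero_le_one (Nat.cast_nonneg _) h1 h2)
  have hcard : (0 : ℝ) + (1 + ((Finset.univ.erase k).card : ℝ)) = N := by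
    rw [Finset.card_erase_of_mem (Finset.mem_univ _), Finset.card_univ, Fintype.card_fin,
      Nat.cast_sub (by omega)]
    push_cast; ring
  rw [hcard] at h3
  convert h3 using 1
  ext z
  rw [PhiA, hτ, Finset.prod_div_distrib]
  have : ((δ + ∑ i, u i : ℝ) : ℂ) + z - ((u k : ℝ) : ℂ)
    = z - ((u k - (δ + ∑ i, u i) : ℝ) : ℂ) := by push_cast; ring
  rw [this]
  ring

lemma MA_eq (N : ℕ) (r tstar : ℝ) (u : Fin N → ℝ) (δ : ℝ) (k : Fin N) (t x : ℝ) (ht : 0 < t)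
    {ι : Type} [Countable ι] (c : ι → ℂ) (l : ι → ℝ)
    (hs : Summable fun i => ‖c i‖ * Real.exp (t * l i ^ 2 / 2))
    (hf : ∀ z, PhiA N r tstar u δ k z = ∑' i, c i * Complex.exp (Complex.I * l i * z)) :
    MA N r tstar u δ k t x = ∑' i, c i * Real.exp (t * l i ^ 2 / 2) *
      Complex.exp (Complex.I * l i * x) := by
  have h := gk_series (fun i => c i * Complex.exp (Complex.I * l i * x)) (fun i => ((-l i : ℝ) : ℂ))
    t ht 0 (by
      refine hs.congr fun i => ?_
      rw [norm_mul, show Complex.I * l i * x = ((l i * x : ℝ) : ℂ) * Complex.I by push_cast; ring,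
        Complex.norm_exp_ofReal_mul_I, Complex.ofReal_re]
      simp)
  rw [MA]
  convert h using 1
  · congr 1; ext w
    rw [hf]
    congr 1
    · simp [gk]
    · congr 1; ext i
      rw [mul_assoc (c i), ← Complex.exp_add]
      congr 2
      push_cast
      ring_nf
      simp only [Complex.I_sq]
      ring
  · congr 1; ext i
    rw [mul_right_comm]
    congr 1
    push_cast
    simp

theorem stmt_10 (N : ℕ) (hN : 2 ≤ N) (r tstar : ℝ) (hr : 0 < r) (htstar : 0 < tstar)
    (k : Fin N) (s t : ℝ) (hs : 0 < s) (hst : s < t) (ht : t < tstar) (x : ℝ) :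
    ∫ w : ℝ, MA N r tstar (fun i => 2 * Real.pi * r * (i : ℕ) / N)
          (-(Real.pi * r * ((N : ℝ) - 2))) k t w *
        ((Real.exp (-(w - x) ^ 2 / (2 * (t - s))) / Real.sqrt (2 * Real.pi * (t - s)) : ℝ) : ℂ)
      = MA N r tstar (fun i => 2 * Real.pi * r * (i : ℕ) / N)
          (-(Real.pi * r * ((N : ℝ) - 2))) k s x := by
  obtain ⟨ι, _, c, l, E, h0, h1, h2, h3⟩ := PhiA_rep N hN r tstar hr htstar
    (fun i => 2 * Real.pi * r * (i : ℕ) / N) (-(Real.pi * r * ((N : ℝ) - 2))) k t ht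
  have ht0 : 0 < t := hs.trans hst
  have hts : 0 < t - s := sub_pos.2 hst
  have st : Summable fun i => ‖c i‖ * Real.exp (t * l i ^ 2 / 2) := by
    refine Summable.of_nonneg_of_le (fun i => by positivity) (fun i => ?_) h2
    have := mul_le_mul_of_nonneg_left (h1 i) ht0.le
    gcongr
    linarith
  have ss : Summable fun i => ‖c i‖ * Real.exp (s * l i ^ 2 / 2) := by
    refine Summable.of_nonneg_of_le (fun i => by positivity) (fun i => ?_) st
    gcongr
  have hf := fun z => (h3 z).2
  rw [MA_eq _ _ _ _ _ _ s x hs c l ss hf]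
  simp_rw [fun w => MA_eq _ _ _ _ _ _ t w ht0 c l st hf]
  have h := gk_series (fun i => c i * Real.exp (t * l i ^ 2 / 2)) (fun i => Complex.I * l i)
    (t - s) hts x (by
      refine st.congr fun i => ?_
      rw [norm_mul, Complex.norm_real, Real.norm_of_nonneg (Real.exp_pos _).le]
      simp)
  simp_rw [mul_comm (∑' i, _)]
  refine (show _ = _ from h).trans ?_
  congr 1; ext i
  rw [Complex.ofReal_exp, Complex.ofReal_exp, mul_assoc (c i), mul_assoc (c i), ← Complex.exp_add,
    ← Complex.exp_add]
  congr 2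
  push_cast
  ring_nf
  simp only [Complex.I_sq]
  ring
end
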